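/- (Greenberg) Let f₁, …, f_m be polynomials in N variables with integer coefficients. Then there exist positive integers C and D with the following property: for every prime p, every ν > v_p(D), and every tuple (x₁, …, x_N) ∈ ℤ_p^N with f_i(x₁, …, x_N) ≡ 0 (mod p^ν) for all i = 1, …, m, there exists a tuple (y₁, …, y_N) ∈ ℤ_p^N such that y_j ≡ x_j (mod p^⌈(ν − v_p(D))/C⌉) for all j and f_i(y₁, …, y_N) = 0 for all i. -/

import Mathlib

open Polynomial in
theorem gb_alg {S : Type*} [CommRing S] (Q : Ideal S[X]) [hQ : Q.IsPrime]
    (hchar : ∀ n : ℕ, n ≠ 0 → (n : S[X]) ∉ Q) :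
    (∀ f ∈ Q, ∀ i, C (f.coeff i) ∈ Q) ∨
    ∃ g ∈ Q, derivative g ∉ Q ∧ C g.leadingCoeff ∉ Q ∧
      ∀ f ∈ Q, ∃ (k : ℕ) (q r : S[X]), C g.leadingCoeff ^ k * f = q * g + r ∧
        ∀ i, C (r.coeff i) ∈ Q := by
  by_cases H : ∀ f ∈ Q, ∀ i, C (f.coeff i) ∈ Q
  · exact Or.inl H
  right
  classical
  have hex : ∃ d : ℕ, ∃ g ∈ Q, (¬ ∀ i, C (g.coeff i) ∈ Q) ∧ g.natDegree = d := by
    push Not at H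
    obtain ⟨f, hf, i, hi⟩ := H
    exact ⟨_, f, hf, fun h => hi (h i), rfl⟩
  obtain ⟨g, hg, hgc, hgd⟩ := Nat.find_spec hex
  have hmin : ∀ f ∈ Q, f.natDegree < g.natDegree → ∀ i, C (f.coeff i) ∈ Q := by
    intro f hf hlt
    by_contra hc
    exact Nat.find_min hex (hgd ▸ hlt) ⟨f, hf, hc, rfl⟩
  have hpos : 0 < g.natDegree := by
    by_contra h0
    have h0 : g.natDegree = 0 := by omega
    apply hgc
    intro i
    rw [eq_C_of_natDegree_eq_zero h0] at hg ⊢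
    rw [coeff_C]
    split_ifs
    · exact hg
    · simp
  have hlc : C g.leadingCoeff ∉ Q := by
    intro hl
    have he : g.eraseLead ∈ Q := by
      have h1 := g.eraseLead_add_C_mul_X_pow
      have h2 : g.eraseLead = g - C g.leadingCoeff * X ^ g.natDegree := by
        rw [← h1]; simp [h1]
      rw [h2]
      exact Q.sub_mem hg (Q.mul_mem_right _ hl)
    have h3 := hmin _ he (by have := g.eraseLead_natDegree_le; omega)
    apply hgc
    intro i
    by_cases hi : i = g.natDegree
    · subst hi; exact hl
    · have := h3 i
      rwa [eraseLead_coeff_of_ne i hi] at this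
  refine ⟨g, hg, ?_, hlc, ?_⟩
  · intro hd
    have h1 := hmin _ hd (natDegree_derivative_lt hpos.ne') (g.natDegree - 1)
    rw [coeff_derivative, Nat.sub_add_cancel hpos, C_mul] at h1
    rcases hQ.mem_or_mem h1 with h | h
    · exact hlc h
    · refine hchar g.natDegree hpos.ne' ?_
      have h5 : ((g.natDegree - 1 : ℕ) : S) + 1 = (g.natDegree : S) := by
        rw [← Nat.cast_succ]; congr 1; omega
      rw [h5] at h
      simpa using h
  · intro f
    induction hn : f.natDegree using Nat.strong_induction_on generalizing f with
    | _ n ih =>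
      intro hf
      by_cases hc : ∀ i, C (f.coeff i) ∈ Q
      · exact ⟨0, 0, f, by simp, hc⟩
      have hle : g.natDegree ≤ f.natDegree := by
        by_contra hlt
        exact hc (hmin f hf (by omega))
      have hlt := natDegree_cancelLeads_lt_of_natDegree_le_natDegree hle (hpos.trans_le hle)
      have hmem : g.cancelLeads f ∈ Q := by
        unfold cancelLeads
        exact Q.sub_mem (Q.mul_mem_left _ hf) (Q.mul_mem_left _ hg)
      obtain ⟨k, q, r, h1, h2⟩ := ih _ (hn ▸ hlt) _ rfl hmem
      refine ⟨k + 1, q + C g.leadingCoeff ^ k * (C f.leadingCoeff * X ^ (f.natDegree - g.natDegree)), r, ?_, h2⟩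
      unfold cancelLeads at h1
      rw [Nat.sub_eq_zero_of_le hle] at h1
      linear_combination h1

theorem gb_dvd_iff {p : ℕ} [Fact p.Prime] (n : ℕ) (x : ℤ_[p]) :
    (p : ℤ_[p]) ^ n ∣ x ↔ ‖x‖ ≤ (p : ℝ) ^ (-(n : ℤ)) := by
  rw [PadicInt.norm_le_pow_iff_mem_span_pow, Ideal.mem_span_singleton]

open Polynomial in
theorem gb_hensel {p : ℕ} [Fact p.Prime] (F : ℤ_[p][X]) (t : ℤ_[p]) (a e : ℕ)
    (h1 : (p : ℤ_[p]) ^ a ∣ F.eval t) (h2 : ¬ (p : ℤ_[p]) ^ (e + 1) ∣ F.derivative.eval t)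
    (hae : 2 * e < a) : ∃ z, F.eval z = 0 ∧ (p : ℤ_[p]) ^ (a - e) ∣ z - t := by
  have hp1 : (1 : ℝ) < p := by exact_mod_cast (Fact.out : p.Prime).one_lt
  have hp0 : (0 : ℝ) < p := by linarith
  rw [gb_dvd_iff] at h1 h2
  have h3 : (p : ℝ) ^ (-(e : ℤ)) ≤ ‖F.derivative.eval t‖ := by
    by_contra hlt
    push Not at hlt
    apply h2
    rw [PadicInt.norm_le_pow_iff_norm_lt_pow_add_one]
    have h0 : -((e + 1 : ℕ) : ℤ) + 1 = -(e : ℤ) := by omega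
    rw [h0]
    exact hlt
  have hpe : (0 : ℝ) < (p : ℝ) ^ (-(e : ℤ)) := by positivity
  have hnorm : ‖F.aeval t‖ < ‖F.derivative.aeval t‖ ^ 2 := by
    simp only [coe_aeval_eq_eval]
    calc ‖F.eval t‖ ≤ (p : ℝ) ^ (-(a : ℤ)) := h1
      _ < (p : ℝ) ^ (-(e : ℤ) + -(e : ℤ)) := by
        apply zpow_lt_zpow_right₀ hp1; omega
      _ = ((p : ℝ) ^ (-(e : ℤ))) ^ 2 := by rw [zpow_add₀ hp0.ne', sq]
      _ ≤ _ := by gcongr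
  obtain ⟨z, hz, hzt, -, -⟩ := hensels_lemma hnorm
  simp only [coe_aeval_eq_eval] at hz hzt
  refine ⟨z, hz, ?_⟩
  obtain ⟨s, hs⟩ := F.binomExpansion t (z - t)
  rw [add_sub_cancel, hz] at hs
  rw [gb_dvd_iff]
  by_cases hw : z - t = 0
  · rw [hw, norm_zero]; positivity
  have hw' : 0 < ‖z - t‖ := norm_pos_iff.mpr hw
  have h4 : F.derivative.eval t * (z - t) = -(F.eval t + s * (z - t) ^ 2) := by
    linear_combination -hs
  have h5 : ‖F.derivative.eval t‖ * ‖z - t‖ ≤ max ‖F.eval t‖ ‖s * (z - t) ^ 2‖ := by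
    rw [← norm_mul, h4, norm_neg]
    exact PadicInt.nonarchimedean _ _
  have h6 : ‖s * (z - t) ^ 2‖ ≤ ‖z - t‖ * ‖z - t‖ := by
    rw [norm_mul, norm_pow, sq]
    have := PadicInt.norm_le_one s
    nlinarith [mul_pos hw' hw']
  have h7 : ‖F.derivative.eval t‖ * ‖z - t‖ ≤ ‖F.eval t‖ := by
    rcases le_max_iff.mp h5 with h | h
    · exact h
    · exfalso
      nlinarith
  have h8 : (p : ℝ) ^ (-(e : ℤ)) * ‖z - t‖ ≤ (p : ℝ) ^ (-(e : ℤ)) * (p : ℝ) ^ (-((a - e : ℕ) : ℤ)) := by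
    rw [← zpow_add₀ hp0.ne']
    have : -(e : ℤ) + -((a - e : ℕ) : ℤ) = -(a : ℤ) := by omega
    rw [this]
    exact le_trans (le_trans (by gcongr) h7) h1
  exact le_of_mul_le_mul_left h8 hpe

theorem gb_congr {σ A : Type*} [CommRing A] (d : A) (x y : σ → A) (h : ∀ j, d ∣ y j - x j)
    (f : MvPolynomial σ ℤ) : d ∣ MvPolynomial.aeval y f - MvPolynomial.aeval x f := by
  induction f using MvPolynomial.induction_on with
  | C a => simp
  | add f g hf hg =>
    rw [map_add, map_add]
    convert dvd_add hf hg using 1; ring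
  | mul_X f j hf =>
    rw [map_mul, map_mul, MvPolynomial.aeval_X, MvPolynomial.aeval_X]
    have : MvPolynomial.aeval y f * y j - MvPolynomial.aeval x f * x j =
      (MvPolynomial.aeval y f - MvPolynomial.aeval x f) * y j
        + MvPolynomial.aeval x f * (y j - x j) := by ring
    rw [this]
    exact dvd_add (hf.mul_right _) ((h j).mul_left _)

theorem gb_eval {n : ℕ} {A : Type*} [CommRing A] (t : A) (y : Fin n → A)
    (f : MvPolynomial (Fin (n + 1)) ℤ) :
    MvPolynomial.aeval (Fin.cons t y : Fin (n + 1) → A) f =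
      ((MvPolynomial.finSuccEquiv ℤ n f).map
        ((MvPolynomial.aeval y : MvPolynomial (Fin n) ℤ →ₐ[ℤ] A) : MvPolynomial (Fin n) ℤ →+* A)).eval t := by
  induction f using MvPolynomial.induction_on with
  | C a =>
    simp
  | add f g hf hg => simp only [map_add, Polynomial.map_add, Polynomial.eval_add, hf, hg]
  | mul_X f j hf =>
    rw [map_mul, map_mul, Polynomial.map_mul, Polynomial.eval_mul, hf]
    congr 1
    refine Fin.cases ?_ (fun j => ?_) j
    · simp [MvPolynomial.finSuccEquiv_X_zero]
    · simp [MvPolynomial.finSuccEquiv_X_succ]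


theorem gb_chart (n : ℕ) : ∀ (P : Ideal (MvPolynomial (Fin n) ℤ)) [P.IsPrime],
    (∀ k : ℕ, k ≠ 0 → (k : MvPolynomial (Fin n) ℤ) ∉ P) →
    ∃ h ∉ P, ∃ c : ℕ, ∀ (p : ℕ) [Fact p.Prime] (x : Fin n → ℤ_[p]) (e ν : ℕ),
      (∀ f ∈ P, (p : ℤ_[p]) ^ ν ∣ MvPolynomial.aeval x f) →
      (¬ (p : ℤ_[p]) ^ (e + 1) ∣ MvPolynomial.aeval x h) → c * e < ν →
      ∃ y : Fin n → ℤ_[p], (∀ j, (p : ℤ_[p]) ^ (ν - c * e) ∣ y j - x j) ∧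
        ∀ f ∈ P, MvPolynomial.aeval y f = 0 := by
  induction n with
  | zero =>
    intro P hP hchar
    refine ⟨1, (Ideal.ne_top_iff_one P).mp hP.ne_top, 0, ?_⟩
    intro p _ x e ν _ _ _
    refine ⟨x, by simp, ?_⟩
    intro f hf
    obtain ⟨a, rfl⟩ := MvPolynomial.C_surjective (Fin 0) f
    have ha : a = 0 := by
      by_contra ha
      apply hchar a.natAbs (by omega)
      have h1 : (MvPolynomial.C a : MvPolynomial (Fin 0) ℤ) = ((a : ℤ) : MvPolynomial (Fin 0) ℤ) := by
        simp
      rw [h1] at hf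
      rcases Int.natAbs_eq a with h | h
      · rw [h] at hf; simpa using hf
      · rw [h] at hf; simpa using hf
    simp [ha]
  | succ n ih =>
    intro P hP hchar
    let E := (MvPolynomial.finSuccEquiv ℤ n)
    let Q : Ideal (Polynomial (MvPolynomial (Fin n) ℤ)) := P.comap (E.symm : _ →+* MvPolynomial (Fin (n+1)) ℤ)
    have hQ : Q.IsPrime := Ideal.comap_isPrime _ _
    have memQ : ∀ f, f ∈ P ↔ E f ∈ Q := by
      intro f
      simp [Q, Ideal.mem_comap]
    have memQ' : ∀ f, f ∈ Q ↔ E.symm f ∈ P := fun f => Iff.rfl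
    let P' : Ideal (MvPolynomial (Fin n) ℤ) := Q.comap Polynomial.C
    have hP' : P'.IsPrime := Ideal.comap_isPrime _ _
    have hcharQ : ∀ k : ℕ, k ≠ 0 → (k : Polynomial (MvPolynomial (Fin n) ℤ)) ∉ Q := by
      intro k hk hm
      apply hchar k hk
      rw [memQ]
      simpa using hm
    obtain ⟨h', hh', c', H⟩ := ih P' (by
      intro k hk hm
      apply hcharQ k hk
      have : Polynomial.C (k : MvPolynomial (Fin n) ℤ) ∈ Q := hm
      simpa using this)
    -- evaluation of elements
    have evE : ∀ {p : ℕ} [Fact p.Prime] (t : ℤ_[p]) (y : Fin n → ℤ_[p]) f,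
        MvPolynomial.aeval (Fin.cons t y : Fin (n + 1) → ℤ_[p]) (E.symm f) =
        (f.map ((MvPolynomial.aeval y : MvPolynomial (Fin n) ℤ →ₐ[ℤ] ℤ_[p]) :
          MvPolynomial (Fin n) ℤ →+* ℤ_[p])).eval t := by
      intro p _ t y f
      rw [gb_eval]
      congr 2
      exact E.apply_symm_apply f
    have evC : ∀ {p : ℕ} [Fact p.Prime] (t : ℤ_[p]) (y : Fin n → ℤ_[p]) f,
        MvPolynomial.aeval (Fin.cons t y : Fin (n + 1) → ℤ_[p]) (E.symm (Polynomial.C f)) =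
        MvPolynomial.aeval y f := by
      intro p _ t y f
      rw [evE, Polynomial.map_C, Polynomial.eval_C]; rfl
    -- a polynomial with coefficients in P' vanishes where P' vanishes
    have van : ∀ {p : ℕ} [Fact p.Prime] (t : ℤ_[p]) (y : Fin n → ℤ_[p]),
        (∀ f ∈ P', MvPolynomial.aeval y f = 0) →
        ∀ r, (∀ i, Polynomial.C (Polynomial.coeff r i) ∈ Q) →
        MvPolynomial.aeval (Fin.cons t y : Fin (n + 1) → ℤ_[p]) (E.symm r) = 0 := by
      intro p _ t y hy r hr
      rw [evE]
      have : r.map ((MvPolynomial.aeval y : MvPolynomial (Fin n) ℤ →ₐ[ℤ] ℤ_[p]) :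
          MvPolynomial (Fin n) ℤ →+* ℤ_[p]) = 0 := by
        ext1 i
        rw [Polynomial.coeff_map]
        simpa using hy _ (hr i)
      rw [this, Polynomial.eval_zero]
    rcases gb_alg Q hcharQ with hA | ⟨g, hg, hg', hlc, hdiv⟩
    · refine ⟨E.symm (Polynomial.C h'), hh', c', ?_⟩
      intro p _ x e ν hx hxe hν
      obtain ⟨t, x, rfl⟩ : ∃ t x', x = Fin.cons t x' := ⟨x 0, Fin.tail x, (Fin.cons_self_tail x).symm⟩
      rw [evC] at hxe
      obtain ⟨y, hy, hy0⟩ := H p x e ν (by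
        intro f hf
        rw [← evC t]
        exact hx _ hf) hxe hν
      refine ⟨Fin.cons t y, ?_, ?_⟩
      · intro j
        refine Fin.cases ?_ (fun j => ?_) j
        · simp
        · simpa using hy j
      · intro f hf
        have h1 := van t y hy0 (E f) (hA _ ((memQ f).mp hf))
        rwa [E.symm_apply_apply] at h1
    · have hh : Polynomial.C h' * Polynomial.C g.leadingCoeff * Polynomial.derivative g ∉ Q := by
        intro hm
        rcases hQ.mem_or_mem hm with hm | hm
        · rcases hQ.mem_or_mem hm with hm | hm
          · exact hh' hm
          · exact hlc hm
        · exact hg' hm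
      refine ⟨E.symm (Polynomial.C h' * Polynomial.C g.leadingCoeff * Polynomial.derivative g), hh, c' + 2, ?_⟩
      intro p _ x e ν hx hxe hν
      obtain ⟨t, x, rfl⟩ : ∃ t x', x = Fin.cons t x' := ⟨x 0, Fin.tail x, (Fin.cons_self_tail x).symm⟩
      rw [map_mul, map_mul, map_mul, map_mul] at hxe
      have e1 : ¬ (p : ℤ_[p]) ^ (e + 1) ∣ MvPolynomial.aeval x h' := by
        intro hd
        rw [← evC t] at hd
        exact hxe ((hd.mul_right _).mul_right _)
      have e2 : ¬ (p : ℤ_[p]) ^ (e + 1) ∣ MvPolynomial.aeval x g.leadingCoeff := by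
        intro hd
        rw [← evC t] at hd
        exact hxe ((hd.mul_left _).mul_right _)
      have e3 : ¬ (p : ℤ_[p]) ^ (e + 1) ∣ MvPolynomial.aeval (Fin.cons t x : Fin (n + 1) → ℤ_[p])
          (E.symm (Polynomial.derivative g)) := by
        intro hd
        exact hxe (hd.mul_left _)
      have hν2 : c' * e + 2 * e < ν := by rw [add_mul] at hν; exact hν
      obtain ⟨y, hy, hy0⟩ := H p x e ν (by
        intro f hf
        rw [← evC t]
        exact hx _ hf) e1 (by omega)
      set a := ν - c' * e with ha
      have hcons : ∀ j, (p : ℤ_[p]) ^ a ∣ (Fin.cons t y : Fin (n + 1) → ℤ_[p]) j -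
          (Fin.cons t x : Fin (n + 1) → ℤ_[p]) j := by
        intro j
        refine Fin.cases ?_ (fun j => ?_) j
        · simp
        · simpa using hy j
      have hea : (p : ℤ_[p]) ^ (e + 1) ∣ (p : ℤ_[p]) ^ a := pow_dvd_pow _ (by omega)
      have g1 : (p : ℤ_[p]) ^ a ∣ MvPolynomial.aeval (Fin.cons t y : Fin (n + 1) → ℤ_[p]) (E.symm g) := by
        rw [← dvd_sub_left ((pow_dvd_pow _ (by omega)).trans (hx _ hg))]
        exact gb_congr _ _ _ hcons _
      have g2 : ¬ (p : ℤ_[p]) ^ (e + 1) ∣ MvPolynomial.aeval (Fin.cons t y : Fin (n + 1) → ℤ_[p])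
          (E.symm (Polynomial.derivative g)) := by
        intro hd
        apply e3
        rw [← dvd_sub_right hd]
        exact hea.trans (gb_congr _ _ _ hcons _)
      have g3 : MvPolynomial.aeval y g.leadingCoeff ≠ 0 := by
        intro h0
        apply e2
        have := hea.trans (gb_congr _ _ _ hy g.leadingCoeff)
        rw [h0, zero_sub, dvd_neg] at this
        exact this
      rw [evE] at g1 g2
      rw [← Polynomial.derivative_map] at g2
      obtain ⟨z, hz, hzt⟩ := gb_hensel _ t a e g1 g2 (by omega)
      rw [← evE] at hz
      refine ⟨Fin.cons z y, ?_, ?_⟩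
      · intro j
        have hle : ν - (c' + 2) * e ≤ a - e := by rw [add_mul]; omega
        refine Fin.cases ?_ (fun j => ?_) j
        · simpa using (pow_dvd_pow _ hle).trans hzt
        · simpa using (pow_dvd_pow _ (hle.trans (Nat.sub_le _ _))).trans (hy j)
      · intro f hf
        obtain ⟨k, q, r, h1, h2⟩ := hdiv _ ((memQ f).mp hf)
        have h3 := congrArg (fun u => MvPolynomial.aeval (Fin.cons z y : Fin (n + 1) → ℤ_[p]) (E.symm u)) h1
        simp only [map_mul, map_add, map_pow, hz, van z y hy0 r h2, evC, E.symm_apply_apply] at h3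
        simp only [mul_zero, add_zero] at h3
        rcases mul_eq_zero.mp h3 with h | h
        · exact absurd h (pow_ne_zero _ g3)
        · exact h


def GbProp {N : ℕ} (I : Ideal (MvPolynomial (Fin N) ℤ)) (C D : ℕ) : Prop :=
  ∀ (p : ℕ) [Fact p.Prime], ∀ ν k : ℕ, padicValNat p D < ν → padicValNat p D + C * k < ν + C →
    ∀ x : Fin N → ℤ_[p], (∀ f ∈ I, (p : ℤ_[p]) ^ ν ∣ MvPolynomial.aeval x f) →
    ∃ y : Fin N → ℤ_[p], (∀ j, (p : ℤ_[p]) ^ k ∣ y j - x j) ∧ ∀ f ∈ I, MvPolynomial.aeval y f = 0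

theorem GbProp.mono {N : ℕ} {I : Ideal (MvPolynomial (Fin N) ℤ)} {C D : ℕ} (h : GbProp I C D)
    (C' D' : ℕ) (hC : 0 < C') (hD : 0 < D) (hD' : 0 < D') : GbProp I (C * C') (D * D') := by
  intro p _ ν k h1 h2 x hx
  rw [padicValNat.mul hD.ne' hD'.ne'] at h1 h2
  refine h p ν k (by omega) ?_ x hx
  rcases k with _ | k
  · simp; omega
  · have : C * k ≤ C * C' * k := by
      gcongr
      exact Nat.le_mul_of_pos_right _ hC
    rw [mul_add] at h2 ⊢
    omega

theorem gb_sup {N : ℕ} {p : ℕ} [Fact p.Prime] (I : Ideal (MvPolynomial (Fin N) ℤ))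
    (a : MvPolynomial (Fin N) ℤ) (x : Fin N → ℤ_[p]) (d : ℤ_[p])
    (h1 : ∀ f ∈ I, d ∣ MvPolynomial.aeval x f) (h2 : d ∣ MvPolynomial.aeval x a) :
    ∀ f ∈ I ⊔ Ideal.span {a}, d ∣ MvPolynomial.aeval x f := by
  intro f hf
  obtain ⟨u, hu, v, hv, rfl⟩ := Submodule.mem_sup.mp hf
  obtain ⟨w, rfl⟩ := Ideal.mem_span_singleton'.mp hv
  rw [map_add, map_mul]
  exact dvd_add (h1 u hu) (h2.mul_left _)

theorem gb_arith (m ν d C k : ℕ) (hm : 0 < m) (h1 : m * d < ν)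
    (h2 : m * d + C * m * k < ν + C * m) :
    ∃ μ, d < μ ∧ d + C * k < μ + C ∧ 1 ≤ μ ∧ m * (μ - 1) < ν ∧ μ ≤ ν := by
  refine ⟨(ν - 1) / m + 1, ?_, ?_, Nat.le_add_left _ _, ?_, ?_⟩
  · have : d ≤ (ν - 1) / m := by
      rw [Nat.le_div_iff_mul_le hm]; rw [mul_comm] at h1; omega
    omega
  · have h3 : ν ≤ m * ((ν - 1) / m + 1) := by
      have := Nat.lt_mul_div_succ (ν - 1) hm
      omega
    have : m * (d + C * k) < m * ((ν - 1) / m + 1 + C) := by nlinarith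
    exact lt_of_mul_lt_mul_left this (Nat.zero_le _)
  · have := Nat.mul_div_le (ν - 1) m
    simp only [Nat.add_sub_cancel]
    omega
  · have := Nat.div_le_self (ν - 1) m
    omega

theorem gb_prime {R : Type*} [CommRing R] [IsDomain R] {p : R} (hp : Prime p) (a b : R) (e : ℕ)
    (ha : ¬ p ^ (e + 1) ∣ a) (h : p ^ (e + e + 1) ∣ a * b) : p ^ (e + 1) ∣ b := by
  classical
  have hex : ∃ k, ¬ p ^ (k + 1) ∣ a := ⟨e, ha⟩
  obtain ⟨k, hk, hke, hka⟩ : ∃ k, ¬ p ^ (k + 1) ∣ a ∧ k ≤ e ∧ p ^ k ∣ a := by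
    refine ⟨Nat.find hex, Nat.find_spec hex, Nat.find_min' hex ha, ?_⟩
    rcases hk : Nat.find hex with _ | k
    · simp
    · have := Nat.find_min hex (m := k) (by omega)
      push Not at this
      exact this
  obtain ⟨a', rfl⟩ := hka
  have h1 : ¬ p ∣ a' := fun hd => hk (by rw [pow_succ]; exact mul_dvd_mul_left _ hd)
  have h2 : p ^ (k + (e + 1)) ∣ p ^ k * a' * b := (pow_dvd_pow _ (by omega)).trans h
  rw [pow_add, mul_assoc] at h2
  exact hp.pow_dvd_of_dvd_mul_left _ h1 ((mul_dvd_mul_iff_left (pow_ne_zero _ hp.ne_zero)).mp h2)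

theorem gb_main {N : ℕ} (I : Ideal (MvPolynomial (Fin N) ℤ)) :
    ∃ C D : ℕ, 0 < C ∧ 0 < D ∧ GbProp I C D := by
  induction I using IsNoetherian.induction with
  | hgt I ih =>
  have key : ∀ a ∉ I, ∃ C D : ℕ, 0 < C ∧ 0 < D ∧ GbProp (I ⊔ Ideal.span {a}) C D := by
    intro a ha
    apply ih
    refine lt_of_le_of_ne le_sup_left ?_
    intro h
    apply ha
    rw [h]
    exact Ideal.mem_sup_right (Ideal.mem_span_singleton_self a)
  by_cases hchar : ∀ k : ℕ, k ≠ 0 → (k : MvPolynomial (Fin N) ℤ) ∉ I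
  swap
  · push Not at hchar
    obtain ⟨D, hD, hDI⟩ := hchar
    refine ⟨1, D, one_pos, by omega, ?_⟩
    intro p _ ν k h1 _ x hx
    exfalso
    have h := hx _ hDI
    rw [map_natCast] at h
    have h' : p ^ ν ∣ D := by
      have h3 := (PadicInt.pow_p_dvd_int_iff (p := p) ν (D : ℤ)).mp (by simpa using h)
      exact_mod_cast h3
    rw [padicValNat_dvd_iff_le hD] at h'
    omega
  by_cases hP : Ideal.IsPrime I
  · obtain ⟨h, hh, c, H⟩ := gb_chart N I hchar
    obtain ⟨C, D, hC, hD, HJ⟩ := key h hh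
    refine ⟨C * (c + 1), D ^ (c + 1), by positivity, by positivity, ?_⟩
    intro p _ ν k h1 h2 x hx
    rw [padicValNat.pow] at h1 h2
    obtain ⟨μ, m1, m2, m3, m4, m5⟩ := gb_arith (c + 1) ν _ C k (by omega) h1 h2
    by_cases hd : (p : ℤ_[p]) ^ μ ∣ MvPolynomial.aeval x h
    · obtain ⟨y, hy, hy0⟩ := HJ p μ k m1 m2 x
        (gb_sup _ _ _ _ (fun f hf => (pow_dvd_pow _ m5).trans (hx f hf)) hd)
      exact ⟨y, hy, fun f hf => hy0 f (Ideal.mem_sup_left hf)⟩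
    · obtain ⟨e, rfl⟩ : ∃ e, μ = e + 1 := ⟨μ - 1, by omega⟩
      rw [Nat.add_sub_cancel, add_mul, one_mul] at m4
      obtain ⟨y, hy, hy0⟩ := H p x e ν hx hd (by omega)
      refine ⟨y, fun j => (pow_dvd_pow _ ?_).trans (hy j), hy0⟩
      have : k ≤ e + 1 := by
        rcases k with _ | k
        · omega
        · have : k ≤ C * k := Nat.le_mul_of_pos_left _ hC
          rw [mul_add] at m2
          omega
      omega
  · by_cases htop : I = ⊤
    · exact absurd (htop ▸ Submodule.mem_top) (hchar 1 one_ne_zero)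
    obtain ⟨a, ha, b, hb, hab⟩ := (Ideal.not_isPrime_iff.mp hP).resolve_left htop
    obtain ⟨C1, D1, hC1, hD1, H1⟩ := key a ha
    obtain ⟨C2, D2, hC2, hD2, H2⟩ := key b hb
    replace H1 := H1.mono C2 D2 hC2 hD1 hD2
    replace H2 := H2.mono C1 D1 hC1 hD2 hD1
    rw [mul_comm C2, mul_comm D2] at H2
    have hC : 0 < C1 * C2 := by positivity
    have hD : 0 < D1 * D2 := by positivity
    generalize C1 * C2 = C at *
    generalize D1 * D2 = D at *
    refine ⟨C * 2, D ^ 2, by positivity, by positivity, ?_⟩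
    intro p _ ν k h1 h2 x hx
    rw [padicValNat.pow] at h1 h2
    obtain ⟨μ, m1, m2, m3, m4, m5⟩ := gb_arith 2 ν _ C k (by omega) h1 h2
    have hI := fun f hf => (pow_dvd_pow (p : ℤ_[p]) m5).trans (hx f hf)
    have hor : (p : ℤ_[p]) ^ μ ∣ MvPolynomial.aeval x a ∨ (p : ℤ_[p]) ^ μ ∣ MvPolynomial.aeval x b := by
      have h3 := hx _ hab
      rw [map_mul] at h3
      obtain ⟨e, rfl⟩ : ∃ e, μ = e + 1 := ⟨μ - 1, by omega⟩
      have h4 : (p : ℤ_[p]) ^ (e + e + 1) ∣ MvPolynomial.aeval x a * MvPolynomial.aeval x b :=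
        (pow_dvd_pow _ (by omega)).trans h3
      by_cases ha0 : (p : ℤ_[p]) ^ (e + 1) ∣ MvPolynomial.aeval x a
      · exact Or.inl ha0
      · right
        exact gb_prime PadicInt.prime_p _ _ e ha0 h4
    rcases hor with hd | hd
    · obtain ⟨y, hy, hy0⟩ := H1 p μ k m1 m2 x (gb_sup _ _ _ _ hI hd)
      exact ⟨y, hy, fun f hf => hy0 f (Ideal.mem_sup_left hf)⟩
    · obtain ⟨y, hy, hy0⟩ := H2 p μ k m1 m2 x (gb_sup _ _ _ _ hI hd)
      exact ⟨y, hy, fun f hf => hy0 f (Ideal.mem_sup_left hf)⟩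

/-- **Theorem (Greenberg).**
Let `f₁, …, f_m` be polynomials in `N` variables over `ℤ`. There exist positive integers `C`
and `D` such that for every prime `p`, every `ν > v_p D`, and every `x ∈ ℤ_[p]^N` with
`f_i(x) ≡ 0 (mod p^ν)` for all `i`, there exists `y ∈ ℤ_[p]^N` with
`y_j ≡ x_j (mod p^⌈(ν - v_p D)/C⌉)` for all `j` and `f_i(y) = 0` for all `i`. -/
theorem stmt_3 (N m : ℕ) (f : Fin m → MvPolynomial (Fin N) ℤ) :
    ∃ C D : ℕ, 0 < C ∧ 0 < D ∧
      ∀ (p : ℕ) [Fact p.Prime], ∀ ν : ℕ, padicValNat p D < ν →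
        ∀ x : Fin N → ℤ_[p],
          (∀ i, (p : ℤ_[p]) ^ ν ∣ MvPolynomial.aeval x (f i)) →
          ∃ y : Fin N → ℤ_[p],
            (∀ j, (p : ℤ_[p]) ^ ⌈((ν : ℝ) - (padicValNat p D : ℝ)) / (C : ℝ)⌉₊ ∣ y j - x j) ∧
            (∀ i, MvPolynomial.aeval y (f i) = 0) := by
  obtain ⟨C, D, hC, hD, H⟩ := gb_main (Ideal.span (Set.range f))
  refine ⟨C, D, hC, hD, ?_⟩
  intro p _ ν hν x hx
  have hC' : (0 : ℝ) < C := by exact_mod_cast hC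
  obtain ⟨y, hy, hy0⟩ := H p ν ⌈((ν : ℝ) - (padicValNat p D : ℝ)) / (C : ℝ)⌉₊ hν (by
    have h0 : (0 : ℝ) ≤ ((ν : ℝ) - (padicValNat p D : ℝ)) / (C : ℝ) := by
      apply div_nonneg _ hC'.le
      have : (padicValNat p D : ℝ) < ν := by exact_mod_cast hν
      linarith
    have h1 := Nat.ceil_lt_add_one h0
    have h2 := mul_lt_mul_of_pos_left h1 hC'
    rw [mul_add, mul_div_cancel₀ _ hC'.ne'] at h2
    have h3 : ((padicValNat p D : ℝ)) + C * (⌈((ν : ℝ) - (padicValNat p D : ℝ)) / (C : ℝ)⌉₊ : ℝ) < ν + C := by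
      linarith
    exact_mod_cast h3) x (by
    intro g hg
    induction hg using Submodule.span_induction with
    | mem g hg => obtain ⟨i, rfl⟩ := hg; exact hx i
    | zero => simp
    | add u v _ _ hu hv => rw [map_add]; exact dvd_add hu hv
    | smul u v _ hv => rw [smul_eq_mul, map_mul]; exact hv.mul_left _)
  exact ⟨y, hy, fun i => hy0 _ (Ideal.subset_span ⟨i, rfl⟩)⟩
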